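/- The index set EXL = {e : e codes a u.c.e. family that is TxtEx-learnable by some learner} is Σ⁰₄-hard: every Σ⁰₄ set many-one reduces to EXL via a computable function. -/

import Mathlib

/-- `Wset e` is the `e`-th computably enumerable set: the domain of the `e`-th
partial computable function in the standard numbering by codes. -/
def Wset (e : ℕ) : Set ℕ :=
  {x | ((Denumerable.ofNat Nat.Partrec.Code e).eval x).Dom}

/-- The `i`-th column `{x : ⟨i,x⟩ ∈ W_a}` of the c.e. set coded by `a`;
the number `a` codes the u.c.e. family whose members are its columns. -/
def column (a i : ℕ) : Set ℕ := {x | Nat.pair i x ∈ Wset a}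

/-- The initial segment of length `n` of an enumeration `f`. -/
def initSeg (f : ℕ → ℕ) (n : ℕ) : List ℕ := (List.range n).map f

/-- The `m`-th computable learner in the standard effective enumeration of all
partial computable functions from finite sequences to ℕ. -/
def learnerOfCode (m : ℕ) : List ℕ →. ℕ :=
  fun σ => (Denumerable.ofNat Nat.Partrec.Code m).eval (Encodable.encode σ)

/-- `M` TxtFin-identifies the enumeration `f` (here `Option.none` plays the
role of the symbol `?`). -/
def TxtFinIdentifies (M : List ℕ →. Option ℕ) (f : ℕ → ℕ) : Prop :=
  ∃ n h, (∀ n' < n, M (initSeg f n') = Part.some Option.none) ∧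
    M (initSeg f n) = Part.some (Option.some h) ∧ Wset h = Set.range f

/-- `M` TxtFin-learns the set `S`. -/
def TxtFinLearnsSet (M : List ℕ →. Option ℕ) (S : Set ℕ) : Prop :=
  ∀ f : ℕ → ℕ, Set.range f = S → TxtFinIdentifies M f

/-- `M` TxtEx-identifies the enumeration `f`. -/
def TxtExIdentifies (M : List ℕ →. ℕ) (f : ℕ → ℕ) : Prop :=
  ∃ n, (∃ N, ∀ i ≥ N, M (initSeg f i) = Part.some n) ∧ Wset n = Set.range f

/-- `M` TxtEx-learns the set `S`. -/
def TxtExLearnsSet (M : List ℕ →. ℕ) (S : Set ℕ) : Prop :=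
  ∀ f : ℕ → ℕ, Set.range f = S → TxtExIdentifies M f

/-- `M` TxtBC-identifies the enumeration `f`. -/
def TxtBCIdentifies (M : List ℕ →. ℕ) (f : ℕ → ℕ) : Prop :=
  ∃ N, ∀ i ≥ N, ∃ h, M (initSeg f i) = Part.some h ∧ Wset h = Set.range f

/-- `M` TxtBC-learns the set `S`. -/
def TxtBCLearnsSet (M : List ℕ →. ℕ) (S : Set ℕ) : Prop :=
  ∀ f : ℕ → ℕ, Set.range f = S → TxtBCIdentifies M f

/-- `M` TxtEx*-identifies the enumeration `f`. -/
def TxtExStarIdentifies (M : List ℕ →. ℕ) (f : ℕ → ℕ) : Prop :=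
  ∃ n, (∃ N, ∀ i ≥ N, M (initSeg f i) = Part.some n) ∧
    (symmDiff (Wset n) (Set.range f)).Finite

/-- `M` TxtEx*-learns the set `S`. -/
def TxtExStarLearnsSet (M : List ℕ →. ℕ) (S : Set ℕ) : Prop :=
  ∀ f : ℕ → ℕ, Set.range f = S → TxtExStarIdentifies M f

/-- Indices of cofinite c.e. sets. -/
def COF : Set ℕ := {e | (Wset e)ᶜ.Finite}

/-- Indices of coinfinite c.e. sets. -/
def COINF : Set ℕ := {e | (Wset e)ᶜ.Infinite}

/-- `P` is Σ⁰₃: definable by `∃∀∃` over a computable relation. -/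
def IsSigma3 (P : Set ℕ) : Prop :=
  ∃ R : ℕ → ℕ → ℕ → ℕ → Bool,
    Computable (fun p : ℕ × ℕ × ℕ × ℕ => R p.1 p.2.1 p.2.2.1 p.2.2.2) ∧
    ∀ e, e ∈ P ↔ ∃ x, ∀ y, ∃ z, R e x y z = true

/-- `P` is Σ⁰₄: definable by `∃∀∃∀` over a computable relation. -/
def IsSigma4 (P : Set ℕ) : Prop :=
  ∃ R : ℕ → ℕ → ℕ → ℕ → ℕ → Bool,
    Computable (fun p : ℕ × ℕ × ℕ × ℕ × ℕ =>
      R p.1 p.2.1 p.2.2.1 p.2.2.2.1 p.2.2.2.2) ∧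
    ∀ e, e ∈ P ↔ ∃ x, ∀ y, ∃ z, ∀ w, R e x y z w = true

/-- `P` is Σ⁰₅: definable by `∃∀∃∀∃` over a computable relation. -/
def IsSigma5 (P : Set ℕ) : Prop :=
  ∃ R : ℕ → ℕ → ℕ → ℕ → ℕ → ℕ → Bool,
    Computable (fun p : ℕ × ℕ × ℕ × ℕ × ℕ × ℕ =>
      R p.1 p.2.1 p.2.2.1 p.2.2.2.1 p.2.2.2.2.1 p.2.2.2.2.2) ∧
    ∀ e, e ∈ P ↔ ∃ x, ∀ y, ∃ z, ∀ w, ∃ v, R e x y z w v = true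

/-- `f : ℕ → ℕ` is Δ⁰₂: the pointwise limit of a computable function. -/
def IsDelta2Fun (f : ℕ → ℕ) : Prop :=
  ∃ g : ℕ → ℕ → ℕ, Computable₂ g ∧ ∀ x, ∃ s₀, ∀ s ≥ s₀, g s x = f x

/-- The index set of codes of TxtEx-learnable u.c.e. families. -/
def EXL : Set ℕ :=
  {e | ∃ M : List ℕ →. ℕ, Partrec M ∧ ∀ i, TxtExLearnsSet M (column e i)}

/-- Parametrized families of c.e. sets given by computable matrices have computable indices. -/
theorem exists_computable_index {α : Type*} [Primcodable α] {Q : α → ℕ → ℕ → Bool}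
    (hQ : Computable fun p : (α × ℕ) × ℕ => Q p.1.1 p.1.2 p.2) :
    ∃ h : α → ℕ, Computable h ∧ ∀ a, Wset (h a) = {v | ∃ k, Q a v k = true} := by
  have h1 : Partrec fun p : α × ℕ => Nat.rfind fun k => Part.some (Q p.1 p.2 k) :=
    Partrec.rfind (p := fun (p : α × ℕ) k => Part.some (Q p.1 p.2 k)) hQ.partrec
  obtain ⟨c, hc⟩ := Nat.Partrec.Code.exists_code.1 h1
  refine ⟨fun a => Encodable.encode (Nat.Partrec.Code.curry c (Encodable.encode a)), ?_, ?_⟩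
  · exact Computable.encode.comp ((Nat.Partrec.Code.primrec₂_curry.comp (Primrec.const c)
      Primrec.encode).to_comp)
  · intro a
    ext v
    simp only [Wset, Set.mem_ofPred_eq, Denumerable.ofNat_encode, Nat.Partrec.Code.eval_curry, hc,
      Encodable.decode_prod_val, Nat.unpair_pair, Encodable.encodek, Encodable.decode_nat]
    simpa using Nat.rfind_dom (p := fun k => Part.some (Q a v k))

section NormalForm

/-- Merging of a sequence of existential witnesses: `y` codes a list whose entries with index at
most `x` are witnesses for the respective indices. -/
def mergedMatrix (R : ℕ → ℕ → ℕ → ℕ → ℕ → Bool) (e x y z w : ℕ) : Bool :=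
  !(decide (z.unpair.1 ≤ x)) ||
    !R e z.unpair.1 ((Denumerable.ofNat (List ℕ) y).getD z.unpair.1 0) z.unpair.2 w

/-- `c` codes `x`, `y` and a list of bounds; the `∀∃`-statement with this matrix says that
`y` is the least witness for `x`, and that for `y' < y` the least counterexample is given by the
list of bounds. -/
def leastMatrix (T : ℕ → ℕ → ℕ → ℕ → ℕ → Bool) (e c z w : ℕ) : Bool :=
  decide ((Denumerable.ofNat (List ℕ) c.unpair.2.unpair.2).length = c.unpair.2.unpair.1) &&
    (bif decide (z.unpair.1 = 0) then T e c.unpair.1 c.unpair.2.unpair.1 z.unpair.2 w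
    else !(decide (z.unpair.2.unpair.1 < c.unpair.2.unpair.1)) ||
      (bif decide (z.unpair.1 = 1) then
        !(decide (z.unpair.2.unpair.2 <
          (Denumerable.ofNat (List ℕ) c.unpair.2.unpair.2).getD z.unpair.2.unpair.1 0)) ||
            T e c.unpair.1 z.unpair.2.unpair.1 z.unpair.2.unpair.2 w
      else !T e c.unpair.1 z.unpair.2.unpair.1
        ((Denumerable.ofNat (List ℕ) c.unpair.2.unpair.2).getD z.unpair.2.unpair.1 0)
          z.unpair.2.unpair.2))

theorem forall_exists_mergedMatrix_iff (R : ℕ → ℕ → ℕ → ℕ → ℕ → Bool) (e x : ℕ) :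
    (∃ y, ∀ z, ∃ w, mergedMatrix R e x y z w = true) ↔
      ∀ x' ≤ x, ∃ y, ∀ z, ∃ w, R e x' y z w = false := by
  constructor
  · rintro ⟨y, hy⟩ x' hx'
    refine ⟨(Denumerable.ofNat (List ℕ) y).getD x' 0, fun z => ?_⟩
    obtain ⟨w, hw⟩ := hy (Nat.pair x' z)
    exact ⟨w, by simpa [mergedMatrix, hx'] using hw⟩
  · intro h
    choose! f hf using h
    refine ⟨Encodable.encode ((List.range (x + 1)).map f), fun z => ?_⟩
    by_cases hz : z.unpair.1 ≤ x
    · obtain ⟨w, hw⟩ := hf z.unpair.1 hz z.unpair.2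
      refine ⟨w, ?_⟩
      have : z.unpair.1 < x + 1 := by omega
      simp [mergedMatrix, List.getD_eq_getElem?_getD, this, hw]
    · exact ⟨0, by simp [mergedMatrix, hz]⟩

theorem forall_exists_leastMatrix_iff (T : ℕ → ℕ → ℕ → ℕ → ℕ → Bool) (e c : ℕ) :
    (∀ z, ∃ w, leastMatrix T e c z w = true) ↔
      (Denumerable.ofNat (List ℕ) c.unpair.2.unpair.2).length = c.unpair.2.unpair.1 ∧
      (∀ z, ∃ w, T e c.unpair.1 c.unpair.2.unpair.1 z w = true) ∧
      ∀ y < c.unpair.2.unpair.1,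
        (∀ z < (Denumerable.ofNat (List ℕ) c.unpair.2.unpair.2).getD y 0,
          ∃ w, T e c.unpair.1 y z w = true) ∧
        ∀ w, T e c.unpair.1 y
          ((Denumerable.ofNat (List ℕ) c.unpair.2.unpair.2).getD y 0) w = false := by
  constructor
  · intro h
    have hl : (Denumerable.ofNat (List ℕ) c.unpair.2.unpair.2).length = c.unpair.2.unpair.1 := by
      obtain ⟨w, hw⟩ := h 0
      simp only [leastMatrix, Bool.and_eq_true, decide_eq_true_eq] at hw
      exact hw.1
    refine ⟨hl, fun z => ?_, fun y hy => ⟨fun z hz => ?_, fun w => ?_⟩⟩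
    · obtain ⟨w, hw⟩ := h (Nat.pair 0 z)
      exact ⟨w, by simpa [leastMatrix, hl] using hw⟩
    · obtain ⟨w, hw⟩ := h (Nat.pair 1 (Nat.pair y z))
      refine ⟨w, ?_⟩
      simp only [leastMatrix, hl, Nat.unpair_pair, hy, hz] at hw
      simpa using hw
    · obtain ⟨w', hw⟩ := h (Nat.pair 2 (Nat.pair y w))
      simp only [leastMatrix, hl, Nat.unpair_pair, hy] at hw
      simpa using hw
  · rintro ⟨hl, h1, h2⟩ z
    by_cases z0 : z.unpair.1 = 0
    · obtain ⟨w, hw⟩ := h1 z.unpair.2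
      exact ⟨w, by simp [leastMatrix, hl, z0, hw]⟩
    by_cases hy : z.unpair.2.unpair.1 < c.unpair.2.unpair.1
    swap
    · exact ⟨0, by simp only [leastMatrix, hl, z0, hy]; simp⟩
    by_cases z1 : z.unpair.1 = 1
    · by_cases hz : z.unpair.2.unpair.2 <
          (Denumerable.ofNat (List ℕ) c.unpair.2.unpair.2).getD z.unpair.2.unpair.1 0
      · obtain ⟨w, hw⟩ := (h2 _ hy).1 _ hz
        exact ⟨w, by simp only [leastMatrix, hl, z1, hy, hw]; simp⟩
      · exact ⟨0, by simp only [leastMatrix, hl, z1, hy, hz]; simp⟩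
    · exact ⟨0, by
        simp only [leastMatrix, hl, z0, z1, hy, (h2 _ hy).2]; simp⟩

theorem exists_forall_exists_leastMatrix {T : ℕ → ℕ → ℕ → ℕ → ℕ → Bool} {e x : ℕ}
    (h : ∃ y, ∀ z, ∃ w, T e x y z w = true) :
    ∃ y, ∀ z, ∃ w, leastMatrix T e (Nat.pair x y) z w = true := by
  classical
  have hlt : ∀ y < Nat.find h, ∃ n, (∀ z < n, ∃ w, T e x y z w = true) ∧
      ∀ w, T e x y n w = false := by
    intro y hy
    have h1 : ∃ z, ∀ w, T e x y z w = false := by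
      have := Nat.find_min h hy
      push Not at this
      simpa using this
    refine ⟨Nat.find h1, fun z hz => ?_, Nat.find_spec h1⟩
    have := Nat.find_min h1 hz
    push Not at this
    simpa using this
  choose! n hn using hlt
  refine ⟨Nat.pair (Nat.find h) (Encodable.encode ((List.range (Nat.find h)).map n)), ?_⟩
  rw [forall_exists_leastMatrix_iff]
  simp only [Nat.unpair_pair, Denumerable.ofNat_encode, List.length_map, List.length_range,
    true_and]
  refine ⟨Nat.find_spec h, fun y hy => ?_⟩
  have : ((List.range (Nat.find h)).map n).getD y 0 = n y := by
    simp [List.getD_eq_getElem?_getD, hy]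
  rw [this]
  exact hn y hy

theorem forall_exists_leastMatrix_unique {T : ℕ → ℕ → ℕ → ℕ → ℕ → Bool} {e c d : ℕ}
    (hc : ∀ z, ∃ w, leastMatrix T e c z w = true) (hd : ∀ z, ∃ w, leastMatrix T e d z w = true)
    (hcd : c.unpair.1 = d.unpair.1) : c = d := by
  rw [forall_exists_leastMatrix_iff] at hc hd
  obtain ⟨hc0, hc1, hc2⟩ := hc
  obtain ⟨hd0, hd1, hd2⟩ := hd
  have hy : c.unpair.2.unpair.1 = d.unpair.2.unpair.1 := by
    rcases lt_trichotomy c.unpair.2.unpair.1 d.unpair.2.unpair.1 with h | h | h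
    · obtain ⟨w, hw⟩ := hc1 ((Denumerable.ofNat (List ℕ) d.unpair.2.unpair.2).getD
        c.unpair.2.unpair.1 0)
      rw [hcd, (hd2 _ h).2] at hw
      cases hw
    · exact h
    · obtain ⟨w, hw⟩ := hd1 ((Denumerable.ofNat (List ℕ) c.unpair.2.unpair.2).getD
        d.unpair.2.unpair.1 0)
      rw [← hcd, (hc2 _ h).2] at hw
      cases hw
  have hl : Denumerable.ofNat (List ℕ) c.unpair.2.unpair.2 =
      Denumerable.ofNat (List ℕ) d.unpair.2.unpair.2 := by
    apply List.ext_getElem (by rw [hc0, hd0, hy])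
    intro y hyc hyd
    have h1 := hc2 y (by omega)
    have h2 := hd2 y (by omega)
    rw [List.getD_eq_getElem _ _ hyc] at h1
    rw [List.getD_eq_getElem _ _ hyd] at h2
    rcases lt_trichotomy (Denumerable.ofNat (List ℕ) c.unpair.2.unpair.2)[y]
      (Denumerable.ofNat (List ℕ) d.unpair.2.unpair.2)[y] with h | h | h
    · obtain ⟨w, hw⟩ := h2.1 _ h
      rw [← hcd, h1.2] at hw
      cases hw
    · exact h
    · obtain ⟨w, hw⟩ := h1.1 _ h
      rw [hcd, h2.2] at hw
      cases hw
  have h3 : c.unpair.2.unpair.2 = d.unpair.2.unpair.2 := by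
    have := congrArg Encodable.encode hl
    simpa only [Denumerable.encode_ofNat] using this
  rw [← Nat.pair_unpair c, ← Nat.pair_unpair d, ← Nat.pair_unpair c.unpair.2,
    ← Nat.pair_unpair d.unpair.2, hcd, hy, h3]

theorem computable_mergedMatrix {R : ℕ → ℕ → ℕ → ℕ → ℕ → Bool}
    (hR : Computable (fun p : ℕ × ℕ × ℕ × ℕ × ℕ =>
      R p.1 p.2.1 p.2.2.1 p.2.2.2.1 p.2.2.2.2))
    {α : Type*} [Primcodable α] {e x y z w : α → ℕ} (he : Computable e) (hx : Computable x)
    (hy : Computable y) (hz : Computable z) (hw : Computable w) :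
    Computable fun a => mergedMatrix R (e a) (x a) (y a) (z a) (w a) := by
  have hu := Computable.unpair.comp hz
  have hg : Computable fun a =>
      (Denumerable.ofNat (List ℕ) (y a)).getD (z a).unpair.1 0 :=
    (Primrec.list_getD 0).to_comp.comp ((Computable.ofNat (List ℕ)).comp hy)
      (Computable.fst.comp hu)
  exact Primrec.or.to_comp.comp
    (Primrec.not.to_comp.comp (Primrec.nat_le.decide.to_comp.comp
      (Computable.fst.comp hu) hx))
    (Primrec.not.to_comp.comp (hR.comp (he.pair ((Computable.fst.comp hu).pair
      (hg.pair ((Computable.snd.comp hu).pair hw))))))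

theorem computable_leastMatrix {T : ℕ → ℕ → ℕ → ℕ → ℕ → Bool}
    (hT : Computable (fun p : ℕ × ℕ × ℕ × ℕ × ℕ =>
      T p.1 p.2.1 p.2.2.1 p.2.2.2.1 p.2.2.2.2)) :
    Computable fun p : ℕ × ℕ × ℕ × ℕ => leastMatrix T p.1 p.2.1 p.2.2.1 p.2.2.2 := by
  have he : Computable fun p : ℕ × ℕ × ℕ × ℕ => p.1 := Computable.fst
  have hc : Computable fun p : ℕ × ℕ × ℕ × ℕ => p.2.1.unpair :=
    Computable.unpair.comp (Computable.fst.comp Computable.snd)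
  have hc2 : Computable fun p : ℕ × ℕ × ℕ × ℕ => p.2.1.unpair.2.unpair :=
    Computable.unpair.comp (Computable.snd.comp hc)
  have hz : Computable fun p : ℕ × ℕ × ℕ × ℕ => p.2.2.1.unpair :=
    Computable.unpair.comp (Computable.fst.comp (Computable.snd.comp Computable.snd))
  have hz2 : Computable fun p : ℕ × ℕ × ℕ × ℕ => p.2.2.1.unpair.2.unpair :=
    Computable.unpair.comp (Computable.snd.comp hz)
  have hw : Computable fun p : ℕ × ℕ × ℕ × ℕ => p.2.2.2 :=
    Computable.snd.comp (Computable.snd.comp Computable.snd)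
  have hl : Computable fun p : ℕ × ℕ × ℕ × ℕ =>
      Denumerable.ofNat (List ℕ) p.2.1.unpair.2.unpair.2 :=
    (Computable.ofNat (List ℕ)).comp (Computable.snd.comp hc2)
  have hg : Computable fun p : ℕ × ℕ × ℕ × ℕ =>
      (Denumerable.ofNat (List ℕ) p.2.1.unpair.2.unpair.2).getD p.2.2.1.unpair.2.unpair.1 0 :=
    (Primrec.list_getD 0).to_comp.comp hl (Computable.fst.comp hz2)
  have heq := (Primrec.eq (α := ℕ)).decide.to_comp
  have hlt := Primrec.nat_lt.decide.to_comp
  have hx := Computable.fst.comp hc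
  have b1 := heq.comp (Computable.list_length.comp hl) (Computable.fst.comp hc2)
  have b2 := heq.comp (Computable.fst.comp hz) (Computable.const 0)
  have b3 := hT.comp (he.pair (hx.pair ((Computable.fst.comp hc2).pair
    ((Computable.snd.comp hz).pair hw))))
  have b4 := Primrec.not.to_comp.comp
    (hlt.comp (Computable.fst.comp hz2) (Computable.fst.comp hc2))
  have b5 := heq.comp (Computable.fst.comp hz) (Computable.const 1)
  have b6 := Primrec.or.to_comp.comp
    (Primrec.not.to_comp.comp (hlt.comp (Computable.snd.comp hz2) hg))
    (hT.comp (he.pair (hx.pair ((Computable.fst.comp hz2).pair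
      ((Computable.snd.comp hz2).pair hw)))))
  have b7 := Primrec.not.to_comp.comp
    (hT.comp (he.pair (hx.pair ((Computable.fst.comp hz2).pair
      (hg.pair (Computable.snd.comp hz2))))))
  have b := Primrec.and.to_comp.comp b1
    (Computable.cond b2 b3 (Primrec.or.to_comp.comp b4 (Computable.cond b5 b6 b7)))
  simp only [leastMatrix]
  exact b

/-- Normal form of `Σ⁰₄` sets: a `∀∃`-statement about `e` and `c` that has only finitely many
solutions `c` if `e ∈ P`, and solutions with every possible first component otherwise. -/
theorem IsSigma4.exists_normal_form {P : Set ℕ} (hP : IsSigma4 P) :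
    ∃ S : ℕ → ℕ → ℕ → ℕ → Bool,
      Computable (fun p : ℕ × ℕ × ℕ × ℕ => S p.1 p.2.1 p.2.2.1 p.2.2.2) ∧
      ∀ e, (e ∉ P → ∀ x, ∃ y, ∀ z, ∃ w, S e (Nat.pair x y) z w = true) ∧
        (e ∈ P → {c | ∀ z, ∃ w, S e c z w = true}.Finite) := by
  obtain ⟨R, hR, hP⟩ := hP
  refine ⟨leastMatrix (mergedMatrix R), computable_leastMatrix ?_,
    fun e => ⟨fun he x => ?_, fun he => ?_⟩⟩
  · exact computable_mergedMatrix hR Computable.fst (Computable.fst.comp Computable.snd)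
      (Computable.fst.comp (Computable.snd.comp Computable.snd))
      (Computable.fst.comp (Computable.snd.comp (Computable.snd.comp Computable.snd)))
      (Computable.snd.comp (Computable.snd.comp (Computable.snd.comp Computable.snd)))
  · rw [hP] at he
    push Not at he
    refine exists_forall_exists_leastMatrix ((forall_exists_mergedMatrix_iff R e x).2 ?_)
    intro x' _
    simpa using he x'
  · obtain ⟨x₀, hx₀⟩ := (hP e).1 he
    refine Set.Finite.of_injOn (f := fun c => c.unpair.1) (t := Set.Iio x₀) ?_
      (fun c hc d hd h => forall_exists_leastMatrix_unique hc hd h) (Set.finite_Iio x₀)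
    intro c hc
    by_contra hlt
    have h1 := (forall_exists_mergedMatrix_iff R e c.unpair.1).1
      ⟨_, ((forall_exists_leastMatrix_iff _ e c).1 hc).2.1⟩ x₀ (by simpa using hlt)
    obtain ⟨y, hy⟩ := h1
    obtain ⟨z, hz⟩ := hx₀ y
    obtain ⟨w, hw⟩ := hy z
    rw [hz w] at hw
    cases hw

end NormalForm

section Learnable

/-- The elements of a list, in order of first appearance from right to left. -/
def elemsList (τ : List ℕ) : List ℕ :=
  τ.foldl (fun K v => if v ∈ K then K else v :: K) []

theorem elemsList_concat (τ : List ℕ) (v : ℕ) :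
    elemsList (τ ++ [v]) = if v ∈ elemsList τ then elemsList τ else v :: elemsList τ := by
  rw [elemsList, List.foldl_append]
  rfl

theorem mem_elemsList {τ : List ℕ} {u : ℕ} : u ∈ elemsList τ ↔ u ∈ τ := by
  induction τ using List.reverseRecOn with
  | nil => simp [elemsList]
  | append_singleton τ v ih =>
    rw [elemsList_concat]
    split_ifs with h
    · rw [ih, List.mem_append, List.mem_singleton]
      refine ⟨Or.inl, ?_⟩
      rintro (h' | rfl)
      · exact h'
      · exact ih.1 h
    · rw [List.mem_cons, ih, List.mem_append, List.mem_singleton, or_comm]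

theorem primrec_mem_list : PrimrecRel fun (v : ℕ) (K : List ℕ) => v ∈ K :=
  (Primrec.nat_lt.comp (Primrec.list_idxOf.comp Primrec.fst Primrec.snd)
    (Primrec.list_length.comp Primrec.snd)).of_eq fun _ => List.idxOf_lt_length_iff

theorem primrec_elemsList : Primrec elemsList := by
  have hcons : Primrec fun q : List ℕ × (List ℕ × ℕ) => q.2.2 :: q.2.1 :=
    Primrec.list_cons.comp (Primrec.snd.comp Primrec.snd) (Primrec.fst.comp Primrec.snd)
  have hmem : PrimrecPred fun q : List ℕ × (List ℕ × ℕ) => q.2.2 ∈ q.2.1 :=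
    primrec_mem_list.comp (Primrec.snd.comp Primrec.snd) (Primrec.fst.comp Primrec.snd)
  exact Primrec.list_foldl Primrec.id (Primrec.const [])
    (Primrec.ite hmem (Primrec.fst.comp Primrec.snd) hcons).to₂

theorem mem_initSeg {f : ℕ → ℕ} {n u : ℕ} : u ∈ initSeg f n ↔ ∃ k < n, f k = u := by
  simp [initSeg]

theorem initSeg_succ (f : ℕ → ℕ) (n : ℕ) : initSeg f (n + 1) = initSeg f n ++ [f n] := by
  simp [initSeg, List.range_succ]

theorem headI_initSeg (f : ℕ → ℕ) {n : ℕ} (hn : 0 < n) : (initSeg f n).headI = f 0 := by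
  obtain ⟨m, rfl⟩ := Nat.exists_eq_succ_of_ne_zero hn.ne'
  simp [initSeg, List.range_succ_eq_map]

theorem exists_elemsList_initSeg_eq {f : ℕ → ℕ} (hf : (Set.range f).Finite) :
    ∃ N, {v | v ∈ elemsList (initSeg f N)} = Set.range f ∧
      ∀ i ≥ N, elemsList (initSeg f i) = elemsList (initSeg f N) := by
  have hev : ∀ᶠ N in Filter.atTop, ∀ v ∈ Set.range f, v ∈ initSeg f N := by
    rw [Filter.eventually_all_finite hf]
    rintro _ ⟨k, rfl⟩
    filter_upwards [Filter.eventually_gt_atTop k] with N hN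
    exact mem_initSeg.2 ⟨k, hN, rfl⟩
  obtain ⟨N, hN⟩ := hev.exists_forall_of_atTop
  refine ⟨N, ?_, fun i hi => ?_⟩
  · ext v
    rw [Set.mem_ofPred_eq, mem_elemsList]
    refine ⟨fun h => ?_, hN N le_rfl v⟩
    obtain ⟨k, _, rfl⟩ := mem_initSeg.1 h
    exact ⟨k, rfl⟩
  · induction i, hi using Nat.le_induction with
    | base => rfl
    | succ i hi ih =>
      rw [initSeg_succ, elemsList_concat, if_pos (mem_elemsList.2 (hN i hi _ ⟨i, rfl⟩)), ih]

theorem exists_Wset_eq_column (a i : ℕ) : ∃ b, Wset b = column a i := by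
  refine ⟨Encodable.encode (Nat.Partrec.Code.curry (Denumerable.ofNat Nat.Partrec.Code a) i), ?_⟩
  ext v
  simp [Wset, column, Nat.Partrec.Code.eval_curry]

/-- A family is learnable if its members are tagged, all but finitely many tags belong to finite
sets, and each tag belongs to at most two sets, which are comparable. -/
theorem mem_EXL_of_finite_exceptions {a : ℕ} {H : Set ℕ} (hH : H.Finite)
    (htag : ∀ i, ∀ v ∈ column a i, v.unpair.1 = i.unpair.1)
    (hfin : ∀ i, i.unpair.1 ∉ H → (column a i).Finite)
    (htwo : ∀ i, column a i = column a (Nat.pair i.unpair.1 0) ∨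
      column a i = column a (Nat.pair i.unpair.1 1))
    (hsub : ∀ c, column a (Nat.pair c 0) ⊆ column a (Nat.pair c 1)) : a ∈ EXL := by
  classical
  choose I hI using exists_Wset_eq_column a
  have hd : ∀ c, ∃ d, column a (Nat.pair c 0) = column a (Nat.pair c 1) ∨
      d ∈ column a (Nat.pair c 1) \ column a (Nat.pair c 0) := by
    intro c
    by_cases h : (column a (Nat.pair c 1) \ column a (Nat.pair c 0)).Nonempty
    · exact ⟨h.some, Or.inr h.some_mem⟩
    · rw [Set.not_nonempty_iff_eq_empty, Set.sdiff_eq_empty] at h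
      exact ⟨0, Or.inl ((hsub c).antisymm h)⟩
  choose D hD using hd
  obtain ⟨N, hN⟩ := hH.bddAbove
  let t : ℕ → Option (ℕ × ℕ × ℕ) := fun c =>
    if c ∈ H then some (I (Nat.pair c 0), I (Nat.pair c 1), D c) else none
  let T : List (Option (ℕ × ℕ × ℕ)) := (List.range (N + 1)).map t
  have hT : ∀ c, T.getD c none = t c := by
    intro c
    by_cases hc : c < N + 1
    · simp [T, List.getD_eq_getElem?_getD, hc]
    · have : c ∉ H := fun h => hc (Nat.lt_succ_of_le (hN h))
      simp only [T, t, this, List.getD_eq_getElem?_getD]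
      rw [List.getElem?_eq_none (by simpa using hc)]
      rfl
  obtain ⟨h, hcomp, hh⟩ := exists_computable_index
    (Q := fun (K : List ℕ) v _ => decide (v ∈ K))
    ((primrec_mem_list.comp (Primrec.snd.comp Primrec.fst)
      (Primrec.fst.comp Primrec.fst)).decide.to_comp)
  let L : List ℕ → ℕ := fun τ =>
    Option.casesOn (T.getD τ.headI.unpair.1 none) (h (elemsList τ))
      fun p => if p.2.2 ∈ τ then p.2.1 else p.1
  have hL : Computable L := by
    refine Computable.option_casesOn ?_ (hcomp.comp primrec_elemsList.to_comp) ?_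
    · exact ((Primrec.list_getD none).comp (Primrec.const T)
        (Primrec.fst.comp (Primrec.unpair.comp Primrec.list_headI))).to_comp
    · have hmem : PrimrecPred fun q : List ℕ × (ℕ × ℕ × ℕ) => q.2.2.2 ∈ q.1 :=
        primrec_mem_list.comp (Primrec.snd.comp (Primrec.snd.comp Primrec.snd)) Primrec.fst
      exact (Primrec.ite hmem (Primrec.fst.comp (Primrec.snd.comp Primrec.snd))
        (Primrec.fst.comp Primrec.snd)).to_comp
  refine ⟨fun τ => Part.some (L τ), hL.partrec, fun i f hf => ?_⟩
  have h0 : (f 0).unpair.1 = i.unpair.1 := htag i _ (hf ▸ ⟨0, rfl⟩)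
  have hLf : ∀ n > 0, L (initSeg f n) =
      Option.casesOn (t i.unpair.1) (h (elemsList (initSeg f n)))
        fun p => if p.2.2 ∈ initSeg f n then p.2.1 else p.1 := by
    intro n hn
    simp only [L, headI_initSeg f hn, h0, hT]
  by_cases hi : i.unpair.1 ∈ H
  · simp only [t, hi, if_true] at hLf
    by_cases hdf : D i.unpair.1 ∈ Set.range f
    · obtain ⟨k, hk⟩ := hdf
      refine ⟨I (Nat.pair i.unpair.1 1), ⟨k + 1, fun n hn => ?_⟩, ?_⟩
      · simp only
        rw [hLf n (by omega), if_pos (mem_initSeg.2 ⟨k, by omega, hk⟩)]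
      · rw [hI, hf]
        rcases htwo i with h2 | h2
        · rcases hD i.unpair.1 with h3 | h3
          · rw [h2, h3]
          · exact absurd (h2 ▸ hf ▸ ⟨k, hk⟩) h3.2
        · exact h2.symm
    · refine ⟨I (Nat.pair i.unpair.1 0), ⟨1, fun n hn => ?_⟩, ?_⟩
      · simp only
        rw [hLf n hn, if_neg]
        intro h
        obtain ⟨k, _, hk⟩ := mem_initSeg.1 h
        exact hdf ⟨k, hk⟩
      · rw [hI, hf]
        rcases htwo i with h2 | h2
        · exact h2.symm
        · rcases hD i.unpair.1 with h3 | h3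
          · rw [h2, h3]
          · exact absurd (hf.symm ▸ h2.symm ▸ h3.1) hdf
  · simp only [t, hi, if_false] at hLf
    obtain ⟨N, hN1, hN2⟩ := exists_elemsList_initSeg_eq (hf ▸ hfin i hi)
    refine ⟨h (elemsList (initSeg f N)), ⟨N + 1, fun n hn => ?_⟩, ?_⟩
    · simp only
      rw [hLf n (by omega), hN2 n (by omega)]
    · rw [hh, ← hN1]
      simp

end Learnable

section Diagonalization

open Nat.Partrec (Code)

/-- One step of the search for a mind change of the learner coded by `c.unpair.1`: the stage `n`
codes two extensions and two conjectures, which are tested with fuel `n`. -/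
def diagStep (c n : ℕ) (σ : List ℕ) : List ℕ :=
  let q := Denumerable.ofNat ((List ℕ × List ℕ) × ℕ × ℕ) n.unpair.1
  if (¬ q.2.1 = q.2.2 ∧
      Code.evaln n (Denumerable.ofNat Code c.unpair.1)
        (Encodable.encode ((σ ++ q.1.1).map (Nat.pair c))) = some q.2.1) ∧
      Code.evaln n (Denumerable.ofNat Code c.unpair.1)
        (Encodable.encode ((σ ++ q.1.1 ++ q.1.2).map (Nat.pair c))) = some q.2.2
  then σ ++ q.1.1 ++ q.1.2 ++ List.range n else σ

/-- The sequence of finite initial segments of a text obtained by iterating `diagStep`. -/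
def diagSeq (c n : ℕ) : List ℕ := Nat.rec [] (fun n σ => diagStep c n σ) n

theorem diagSeq_succ (c n : ℕ) : diagSeq c (n + 1) = diagStep c n (diagSeq c n) := rfl

theorem primrec_diagStep : Primrec fun p : (ℕ × ℕ) × List ℕ => diagStep p.1.1 p.1.2 p.2 := by
  have hc : Primrec fun p : (ℕ × ℕ) × List ℕ => p.1.1 := Primrec.fst.comp Primrec.fst
  have hn : Primrec fun p : (ℕ × ℕ) × List ℕ => p.1.2 := Primrec.snd.comp Primrec.fst
  have hq : Primrec fun p : (ℕ × ℕ) × List ℕ =>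
      Denumerable.ofNat ((List ℕ × List ℕ) × ℕ × ℕ) p.1.2.unpair.1 :=
    (Primrec.ofNat _).comp (Primrec.fst.comp (Primrec.unpair.comp hn))
  have hcode : Primrec fun p : (ℕ × ℕ) × List ℕ => Denumerable.ofNat Code p.1.1.unpair.1 :=
    (Primrec.ofNat _).comp (Primrec.fst.comp (Primrec.unpair.comp hc))
  have h1 := Primrec.list_append.comp Primrec.snd (Primrec.fst.comp (Primrec.fst.comp hq))
  have h2 := Primrec.list_append.comp h1 (Primrec.snd.comp (Primrec.fst.comp hq))
  have hev : ∀ {g : (ℕ × ℕ) × List ℕ → List ℕ}, Primrec g →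
      Primrec fun p => Code.evaln p.1.2 (Denumerable.ofNat Code p.1.1.unpair.1)
        (Encodable.encode ((g p).map (Nat.pair p.1.1))) := by
    intro g hg
    exact Code.primrec_evaln.comp ((hn.pair hcode).pair (Primrec.encode.comp
      (Primrec.list_map hg (Primrec₂.natPair.comp (hc.comp Primrec.fst) Primrec.snd).to₂)))
  have ha := Primrec.fst.comp (Primrec.snd.comp hq)
  have hb := Primrec.snd.comp (Primrec.snd.comp hq)
  exact Primrec.ite (((Primrec.eq.comp ha hb).not.and
    (Primrec.eq.comp (hev h1) (Primrec.option_some.comp ha))).and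
    (Primrec.eq.comp (hev h2) (Primrec.option_some.comp hb)))
    (Primrec.list_append.comp h2 (Primrec.list_range.comp hn)) Primrec.snd

theorem primrec_iterate_of_primrec {f : ℕ → ℕ → List ℕ → List ℕ}
    (hf : Primrec fun p : (ℕ × ℕ) × List ℕ => f p.1.1 p.1.2 p.2) :
    Primrec₂ fun c n => (Nat.rec [] (fun n σ => f c n σ) n : List ℕ) := by
  have hr : Primrec fun q : (ℕ × ℕ) × ℕ × List ℕ => ((q.1.1, q.2.1), q.2.2) :=
    ((Primrec.fst.comp Primrec.fst).pair (Primrec.fst.comp Primrec.snd)).pair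
      (Primrec.snd.comp Primrec.snd)
  have h : Primrec₂ fun (p : ℕ × ℕ) (r : ℕ × List ℕ) => f p.1 r.1 r.2 := hf.comp hr
  exact Primrec.nat_rec' (f := fun p : ℕ × ℕ => p.2) (g := fun _ => []) Primrec.snd
    (Primrec.const []) h

theorem primrec_diagSeq : Primrec₂ diagSeq := primrec_iterate_of_primrec primrec_diagStep

/-- `t` codes a list of witnesses for the first `n` existential statements with matrix
`S e c`. -/
def witnessed (S : ℕ → ℕ → ℕ → ℕ → Bool) (e c t n : ℕ) : Bool :=
  Nat.rec true (fun z b => b && S e c z ((Denumerable.ofNat (List ℕ) t).getD z 0)) n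

theorem witnessed_iff {S : ℕ → ℕ → ℕ → ℕ → Bool} {e c t n : ℕ} :
    witnessed S e c t n = true ↔
      ∀ z < n, S e c z ((Denumerable.ofNat (List ℕ) t).getD z 0) = true := by
  induction n with
  | zero => simp [witnessed]
  | succ n ih =>
    have : witnessed S e c t (n + 1) =
      (witnessed S e c t n && S e c n ((Denumerable.ofNat (List ℕ) t).getD n 0)) := rfl
    rw [this, Bool.and_eq_true, ih, Nat.forall_lt_succ_right]

theorem exists_witnessed_iff {S : ℕ → ℕ → ℕ → ℕ → Bool} {e c n : ℕ} :
    (∃ t, witnessed S e c t n = true) ↔ ∀ z < n, ∃ w, S e c z w = true := by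
  simp only [witnessed_iff]
  constructor
  · rintro ⟨t, ht⟩ z hz
    exact ⟨_, ht z hz⟩
  · intro h
    choose! w hw using h
    refine ⟨Encodable.encode ((List.range n).map w), fun z hz => ?_⟩
    simpa [List.getD_eq_getElem?_getD, hz] using hw z hz

theorem computable_forall_lt {α : Type*} [Primcodable α] {g : α → ℕ → Bool} {f : α → ℕ}
    (hg : Computable₂ g) (hf : Computable f) :
    Computable fun p => (Nat.rec true (fun z b => b && g p z) (f p) : Bool) := by
  have hr : Computable fun q : α × ℕ × Bool => g q.1 q.2.1 :=
    Computable₂.comp hg Computable.fst (Computable.fst.comp Computable.snd)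
  have h : Computable₂ fun (p : α) (r : ℕ × Bool) => r.2 && g p r.1 :=
    Primrec.and.to_comp.comp (Computable.snd.comp Computable.snd) hr
  exact Computable.nat_rec (g := fun _ => true) hf (Computable.const true) h

theorem computable_apply_getD {S : ℕ → ℕ → ℕ → ℕ → Bool} {D : ℕ → List ℕ} (hD : Computable D)
    (hS : Computable fun p : ℕ × ℕ × ℕ × ℕ => S p.1 p.2.1 p.2.2.1 p.2.2.2) :
    Computable₂ fun (p : (ℕ × ℕ) × ℕ × ℕ) (z : ℕ) => S p.1.1 p.1.2 z ((D p.2.1).getD z 0) := by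
  have hp : Computable fun q : ((ℕ × ℕ) × ℕ × ℕ) × ℕ => q.1.1 :=
    Computable.fst.comp Computable.fst
  have ht : Computable fun q : ((ℕ × ℕ) × ℕ × ℕ) × ℕ => q.1.2.1 :=
    Computable.fst.comp (Computable.snd.comp Computable.fst)
  have hg : Computable fun q : ((ℕ × ℕ) × ℕ × ℕ) × ℕ => (D q.1.2.1).getD q.2 0 :=
    Computable₂.comp (f := fun l n => List.getD l n 0) (Primrec.list_getD 0).to_comp (hD.comp ht)
      Computable.snd
  have h₁ := Computable.snd.pair hg
  have h₂ := (Computable.snd.comp hp).pair h₁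
  have hr : Computable fun q : ((ℕ × ℕ) × ℕ × ℕ) × ℕ =>
      (q.1.1.1, q.1.1.2, q.2, (D q.1.2.1).getD q.2 0) := (Computable.fst.comp hp).pair h₂
  have h := hS.comp hr
  exact h

theorem computable_witnessed {S : ℕ → ℕ → ℕ → ℕ → Bool}
    (hS : Computable fun p : ℕ × ℕ × ℕ × ℕ => S p.1 p.2.1 p.2.2.1 p.2.2.2) :
    Computable fun p : (ℕ × ℕ) × ℕ × ℕ => witnessed S p.1.1 p.1.2 p.2.1 p.2.2 :=
  computable_forall_lt (computable_apply_getD (Computable.ofNat (List ℕ)) hS)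
    (Computable.snd.comp Computable.snd)

/-- The matrix of the family associated with `S`: column `⟨c, b⟩` has its elements tagged with `c`,
and as long as the statements with matrix `S e c` are witnessed, it receives the elements of
`diagSeq c`, the even numbers, and for `b ≠ 0` also the odd numbers. -/
def familyMatrix (S : ℕ → ℕ → ℕ → ℕ → Bool) (e v k : ℕ) : Bool :=
  (decide (v.unpair.2.unpair.1 = v.unpair.1.unpair.1) &&
    witnessed S e v.unpair.1.unpair.1 k.unpair.1 k.unpair.2) &&
    decide (v.unpair.2.unpair.2 ∈ diagSeq v.unpair.1.unpair.1 k.unpair.2 ∨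
      (v.unpair.2.unpair.2 < k.unpair.2 ∧
        (¬ v.unpair.1.unpair.2 = 0 ∨ v.unpair.2.unpair.2 % 2 = 0)))

theorem computable_familyMatrix {S : ℕ → ℕ → ℕ → ℕ → Bool}
    (hS : Computable fun p : ℕ × ℕ × ℕ × ℕ => S p.1 p.2.1 p.2.2.1 p.2.2.2) :
    Computable fun p : (ℕ × ℕ) × ℕ => familyMatrix S p.1.1 p.1.2 p.2 := by
  have hv : Primrec fun p : (ℕ × ℕ) × ℕ => p.1.2.unpair :=
    Primrec.unpair.comp (Primrec.snd.comp Primrec.fst)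
  have hi : Primrec fun p : (ℕ × ℕ) × ℕ => p.1.2.unpair.1.unpair :=
    Primrec.unpair.comp (Primrec.fst.comp hv)
  have hw : Primrec fun p : (ℕ × ℕ) × ℕ => p.1.2.unpair.2.unpair :=
    Primrec.unpair.comp (Primrec.snd.comp hv)
  have hk : Primrec fun p : (ℕ × ℕ) × ℕ => p.2.unpair := Primrec.unpair.comp Primrec.snd
  have h1 := (Primrec.eq.comp (Primrec.fst.comp hw) (Primrec.fst.comp hi)).decide.to_comp
  have h2 := (computable_witnessed hS).comp
    (((Computable.fst.comp Computable.fst).pair (Primrec.fst.comp hi).to_comp).pair hk.to_comp)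
  have h3 := primrec_mem_list.comp (Primrec.snd.comp hw)
    (primrec_diagSeq.comp (Primrec.fst.comp hi) (Primrec.snd.comp hk))
  have h4 := Primrec.nat_lt.comp (Primrec.snd.comp hw) (Primrec.snd.comp hk)
  have h5 := (Primrec.eq.comp (Primrec.snd.comp hi) (Primrec.const 0)).not
  have h6 := Primrec.eq.comp (Primrec.nat_mod.comp (Primrec.snd.comp hw) (Primrec.const 2))
    (Primrec.const 0)
  exact Primrec.and.to_comp.comp (Primrec.and.to_comp.comp h1 h2)
    (h3.or (h4.and (h5.or h6))).decide.to_comp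

theorem mem_column_iff {S : ℕ → ℕ → ℕ → ℕ → Bool} {a e : ℕ}
    (ha : Wset a = {v | ∃ k, familyMatrix S e v k = true}) {i w : ℕ} :
    w ∈ column a i ↔ w.unpair.1 = i.unpair.1 ∧ ∃ n,
      (∀ z < n, ∃ u, S e i.unpair.1 z u = true) ∧
        (w.unpair.2 ∈ diagSeq i.unpair.1 n ∨
          (w.unpair.2 < n ∧ (¬ i.unpair.2 = 0 ∨ w.unpair.2 % 2 = 0))) := by
  simp only [column, ha, Set.mem_ofPred_eq, familyMatrix, Nat.unpair_pair, Bool.and_eq_true,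
    decide_eq_true_eq]
  constructor
  · rintro ⟨k, ⟨h1, h2⟩, h3⟩
    exact ⟨h1, k.unpair.2, exists_witnessed_iff.1 ⟨_, h2⟩, h3⟩
  · rintro ⟨h1, n, h2, h3⟩
    obtain ⟨t, ht⟩ := exists_witnessed_iff.2 h2
    exact ⟨Nat.pair t n, by simpa using ⟨⟨h1, ht⟩, h3⟩⟩

theorem finite_column {S : ℕ → ℕ → ℕ → ℕ → Bool} {a e : ℕ}
    (ha : Wset a = {v | ∃ k, familyMatrix S e v k = true}) {i : ℕ}
    (hi : ¬ ∀ z, ∃ w, S e i.unpair.1 z w = true) : (column a i).Finite := by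
  push Not at hi
  obtain ⟨z, hz⟩ := hi
  have hfin : (⋃ n ∈ Set.Iic z,
      Nat.pair i.unpair.1 '' ({u | u ∈ diagSeq i.unpair.1 n} ∪ Set.Iio n)).Finite :=
    (Set.finite_Iic z).biUnion fun n _ =>
      ((List.finite_toSet _).union (Set.finite_Iio n)).image _
  refine hfin.subset fun w hw => ?_
  obtain ⟨h1, n, h2, h3⟩ := (mem_column_iff ha).1 hw
  simp only [Set.mem_iUnion]
  refine ⟨n, ?_, w.unpair.2, ?_, by rw [← h1, Nat.pair_unpair]⟩
  · by_contra hn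
    obtain ⟨u, hu⟩ := h2 z (by simpa using hn)
    exact hz u hu
  · rcases h3 with h3 | h3
    · exact Or.inl h3
    · exact Or.inr h3.1

theorem prefix_of_le {σ : ℕ → List ℕ} (hσ : ∀ n, σ n <+: σ (n + 1)) {m n : ℕ} (hmn : m ≤ n) :
    σ m <+: σ n := by
  induction n, hmn using Nat.le_induction with
  | base => exact List.prefix_rfl
  | succ n _ ih => exact ih.trans (hσ n)

/-- A sequence of lists of unbounded length, each a prefix of the next, has a limit. -/
theorem exists_initSeg_eq {σ : ℕ → List ℕ} (hσ : ∀ n, σ n <+: σ (n + 1))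
    (hlen : ∀ k, ∃ n, k < (σ n).length) : ∃ f, ∀ n, initSeg f (σ n).length = σ n := by
  choose N hN using hlen
  refine ⟨fun k => (σ (N k))[k]'(hN k), fun n => ?_⟩
  refine List.ext_getElem (by simp [initSeg]) fun k h1 h2 => ?_
  simp only [initSeg, List.getElem_map, List.getElem_range]
  rcases le_total n (N k) with h | h
  · exact ((prefix_of_le hσ h).getElem h2).symm
  · exact (prefix_of_le hσ h).getElem (hN k)

theorem initSeg_comp (g f : ℕ → ℕ) (n : ℕ) : initSeg (g ∘ f) n = (initSeg f n).map g := by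
  simp [initSeg]

theorem exists_initSeg_eq_append (f : ℕ → ℕ) {m n : ℕ} (h : m ≤ n) :
    ∃ ρ, initSeg f n = initSeg f m ++ ρ := by
  induction n, h using Nat.le_induction with
  | base => exact ⟨[], by simp⟩
  | succ n _ ih =>
    obtain ⟨ρ, hρ⟩ := ih
    exact ⟨ρ ++ [f n], by rw [initSeg_succ, hρ, List.append_assoc]⟩

/-- A text that starts with a given list and continues with a given function. -/
theorem exists_text_extending (τ : List ℕ) (h : ℕ → ℕ) :
    ∃ f, initSeg f τ.length = τ ∧ Set.range f = {v | v ∈ τ} ∪ Set.range h := by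
  refine ⟨fun k => if hk : k < τ.length then τ[k] else h (k - τ.length), ?_, ?_⟩
  · refine List.ext_getElem (by simp [initSeg]) fun k h1 h2 => ?_
    simp [initSeg, h2]
  · ext v
    simp only [Set.mem_range, Set.mem_union, Set.mem_ofPred_eq]
    constructor
    · rintro ⟨k, rfl⟩
      by_cases hk : k < τ.length
      · left
        simp [hk]
      · right
        exact ⟨k - τ.length, by simp [hk]⟩
    · rintro (hv | ⟨k, rfl⟩)
      · obtain ⟨k, hk, rfl⟩ := List.getElem_of_mem hv
        exact ⟨k, by simp [hk]⟩
      · exact ⟨τ.length + k, by simp⟩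

theorem prefix_diagStep (c n : ℕ) (σ : List ℕ) : σ <+: diagStep c n σ := by
  unfold diagStep
  simp only
  split_ifs
  · simp only [List.append_assoc]
    exact List.prefix_append _ _
  · exact List.prefix_rfl

theorem prefix_diagSeq (c : ℕ) {m n : ℕ} (hmn : m ≤ n) : diagSeq c m <+: diagSeq c n :=
  prefix_of_le (fun n => prefix_diagStep c n _) hmn

theorem exists_of_diagStep_ne {c n : ℕ} {σ : List ℕ} (h : diagStep c n σ ≠ σ) :
    ∃ ρ₁ ρ₂ a b, a ≠ b ∧
      a ∈ learnerOfCode c.unpair.1 ((σ ++ ρ₁).map (Nat.pair c)) ∧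
      b ∈ learnerOfCode c.unpair.1 ((σ ++ ρ₁ ++ ρ₂).map (Nat.pair c)) ∧
      diagStep c n σ = σ ++ ρ₁ ++ ρ₂ ++ List.range n := by
  unfold diagStep at h ⊢
  simp only at h ⊢
  split_ifs at h ⊢ with hq
  · exact ⟨_, _, _, _, hq.1.1, Code.evaln_sound hq.1.2, Code.evaln_sound hq.2, rfl⟩
  · exact absurd rfl h

theorem exists_diagStep_ne {c : ℕ} {σ ρ₁ ρ₂ : List ℕ} {a b : ℕ} (hab : a ≠ b)
    (h₁ : a ∈ learnerOfCode c.unpair.1 ((σ ++ ρ₁).map (Nat.pair c)))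
    (h₂ : b ∈ learnerOfCode c.unpair.1 ((σ ++ ρ₁ ++ ρ₂).map (Nat.pair c))) (m : ℕ) :
    ∃ n ≥ m, diagStep c n σ ≠ σ := by
  obtain ⟨k₁, hk₁⟩ := Code.evaln_complete.1 h₁
  obtain ⟨k₂, hk₂⟩ := Code.evaln_complete.1 h₂
  set q : (List ℕ × List ℕ) × ℕ × ℕ := ((ρ₁, ρ₂), a, b) with hq
  set n := Nat.pair (Encodable.encode q) (k₁ + k₂ + m + 1) with hn
  have hle : k₁ + k₂ + m + 1 ≤ n := Nat.right_le_pair _ _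
  have hqn : Denumerable.ofNat ((List ℕ × List ℕ) × ℕ × ℕ) n.unpair.1 = q := by
    rw [hn, Nat.unpair_pair, Denumerable.ofNat_encode]
  refine ⟨n, by omega, fun h => ?_⟩
  unfold diagStep at h
  simp only [hqn, hq] at h
  rw [if_pos ⟨⟨hab, Code.evaln_mono (by omega) hk₁⟩, Code.evaln_mono (by omega) hk₂⟩] at h
  have := congrArg List.length h
  simp only [List.length_append, List.length_range] at this
  omega

/-- The family associated with `S` is not learnable if the tags of satisfied `∀∃`-statements
have all possible first components. -/
theorem not_mem_EXL {S : ℕ → ℕ → ℕ → ℕ → Bool} {a e : ℕ}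
    (ha : Wset a = {v | ∃ k, familyMatrix S e v k = true})
    (hS : ∀ x, ∃ y, ∀ z, ∃ w, S e (Nat.pair x y) z w = true) : a ∉ EXL := by
  rintro ⟨M, hM, hlearn⟩
  obtain ⟨x, hx⟩ : ∃ x, learnerOfCode x = M := by
    obtain ⟨cd, hcd⟩ := Code.exists_code.1 hM
    refine ⟨Encodable.encode cd, funext fun τ => ?_⟩
    simp [learnerOfCode, hcd, Part.map_id']
  obtain ⟨y, hy⟩ := hS x
  set c := Nat.pair x y with hc
  have hcx : learnerOfCode c.unpair.1 = M := by rw [hc, Nat.unpair_pair, hx]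
  have hcol : ∀ b w, w ∈ column a (Nat.pair c b) ↔ w.unpair.1 = c ∧
      ∃ n, w.unpair.2 ∈ diagSeq c n ∨ (w.unpair.2 < n ∧ (¬ b = 0 ∨ w.unpair.2 % 2 = 0)) := by
    intro b w
    rw [mem_column_iff ha]
    simp only [Nat.unpair_pair]
    exact and_congr_right fun _ => exists_congr fun n => and_iff_right fun z _ => hy z
  have hrange : ∀ b (f : ℕ → ℕ), (∀ u, u ∈ Set.range f ↔
      (∃ n, u ∈ diagSeq c n) ∨ ¬ b = 0 ∨ u % 2 = 0) →
      Set.range (Nat.pair c ∘ f) = column a (Nat.pair c b) := by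
    intro b f hf
    ext w
    rw [hcol, Set.range_comp]
    constructor
    · rintro ⟨u, hu, rfl⟩
      simp only [Nat.unpair_pair, true_and]
      rcases (hf u).1 hu with ⟨n, hn⟩ | h
      · exact ⟨n, Or.inl hn⟩
      · exact ⟨u + 1, Or.inr ⟨u.lt_succ_self, h⟩⟩
    · rintro ⟨hw, n, h⟩
      refine ⟨w.unpair.2, (hf _).2 ?_, by rw [← hw, Nat.pair_unpair]⟩
      exact h.imp (fun h => ⟨n, h⟩) fun h => h.2
  by_cases hfire : ∀ m, ∃ n ≥ m, diagStep c n (diagSeq c n) ≠ diagSeq c n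
  · have hlen : ∀ k, ∃ n ≥ k, diagStep c n (diagSeq c n) ≠ diagSeq c n ∧
        List.range k ⊆ diagSeq c (n + 1) ∧ k < (diagSeq c (n + 1)).length := by
      intro k
      obtain ⟨n, hn, hne⟩ := hfire (k + 1)
      obtain ⟨ρ₁, ρ₂, _, _, _, _, _, h⟩ := exists_of_diagStep_ne hne
      refine ⟨n, by omega, hne, ?_, ?_⟩
      · rw [diagSeq_succ, h]
        intro u hu
        rw [List.mem_append, List.mem_range]
        rw [List.mem_range] at hu
        right
        omega
      · rw [diagSeq_succ, h]
        simp only [List.length_append, List.length_range]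
        omega
    obtain ⟨f, hf⟩ := exists_initSeg_eq (σ := diagSeq c) (fun n => prefix_diagStep c n _)
      fun k => (hlen k).elim fun n h => ⟨n + 1, h.2.2.2⟩
    have hsurj : ∀ u, u ∈ Set.range f := by
      intro u
      obtain ⟨n, _, _, h, _⟩ := hlen (u + 1)
      have hu := h (List.mem_range.2 u.lt_succ_self)
      rw [← hf, mem_initSeg] at hu
      obtain ⟨k, _, hk⟩ := hu
      exact ⟨k, hk⟩
    obtain ⟨p, ⟨N, hN⟩, -⟩ := hlearn (Nat.pair c 1) (Nat.pair c ∘ f)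
      (hrange 1 f fun u => by simp [hsurj u])
    obtain ⟨n₀, _, _, _, hn₀⟩ := hlen N
    obtain ⟨n, hn, hne, -⟩ := hlen (n₀ + 1)
    obtain ⟨ρ₁, ρ₂, p₁, p₂, hp, hp₁, hp₂, h⟩ := exists_of_diagStep_ne hne
    have hNn := hn₀.le.trans (prefix_diagSeq c hn).length_le
    have hval : ∀ τ ρ, diagSeq c (n + 1) = τ ++ ρ → N ≤ τ.length →
        M (τ.map (Nat.pair c)) = Part.some p := by
      intro τ ρ hτ hNτ
      obtain ⟨ρ', hρ'⟩ := exists_initSeg_eq_append f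
        (m := τ.length) (n := (diagSeq c (n + 1)).length) (by simp [hτ])
      rw [hf, hτ] at hρ'
      have := (List.append_inj hρ' (by simp [initSeg])).1
      rw [this, ← initSeg_comp]
      exact hN _ hNτ
    rw [hcx, hval _ (ρ₂ ++ List.range n) (by rw [diagSeq_succ, h]; simp)
      (by simp only [List.length_append]; omega), Part.mem_some_iff] at hp₁
    rw [hcx, hval _ (List.range n) (by rw [diagSeq_succ, h])
      (by simp only [List.length_append]; omega), Part.mem_some_iff] at hp₂
    exact hp (hp₁.trans hp₂.symm)
  · push Not at hfire
    obtain ⟨m, hm⟩ := hfire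
    set σ := diagSeq c m with hσ
    have hstab : ∀ n ≥ m, diagSeq c n = σ := by
      intro n hn
      induction n, hn using Nat.le_induction with
      | base => rfl
      | succ n hn ih => rw [diagSeq_succ, hm n hn, ih]
    have hpre : ∀ n u, u ∈ diagSeq c n → u ∈ σ := by
      intro n u hu
      rcases le_total n m with h | h
      · exact (prefix_diagSeq c h).subset hu
      · rwa [hstab n h] at hu
    have hmem : ∀ u, (∃ n, u ∈ diagSeq c n) ↔ u ∈ σ := fun u =>
      ⟨fun ⟨n, hn⟩ => hpre n u hn, fun h => ⟨m, h⟩⟩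
    obtain ⟨f, hf₁, hf₂⟩ := exists_text_extending σ (2 * ·)
    obtain ⟨p, ⟨N, hN⟩, hp⟩ := hlearn (Nat.pair c 0) (Nat.pair c ∘ f) (hrange 0 f fun u => by
      rw [hf₂, hmem]
      simp only [Set.mem_union, Set.mem_ofPred_eq, Set.mem_range, not_true_eq_false, false_or]
      exact or_congr_right ⟨fun ⟨k, hk⟩ => by omega, fun h => ⟨u / 2, by omega⟩⟩)
    obtain ⟨ρ₁, hρ₁⟩ := exists_initSeg_eq_append f (le_max_right N σ.length)
    rw [hf₁] at hρ₁
    obtain ⟨g, hg₁, hg₂⟩ := exists_text_extending (initSeg f (max N σ.length)) id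
    have hg : ∀ u, u ∈ Set.range g := by
      intro u
      rw [hg₂]
      exact Or.inr ⟨u, rfl⟩
    obtain ⟨p', ⟨N', hN'⟩, hp'⟩ := hlearn (Nat.pair c 1) (Nat.pair c ∘ g)
      (hrange 1 g fun u => by simp [hg u])
    obtain ⟨ρ₂, hρ₂⟩ := exists_initSeg_eq_append g
      (le_max_right N' (initSeg f (max N σ.length)).length)
    rw [hg₁, hρ₁] at hρ₂
    have h₁ := hN _ (le_max_left N σ.length)
    rw [initSeg_comp, hρ₁] at h₁
    have h₂ := hN' _ (le_max_left N' (initSeg f (max N σ.length)).length)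
    rw [initSeg_comp, hρ₁, hρ₂] at h₂
    by_cases hpp : p = p'
    · have heq : Set.range (Nat.pair c ∘ f) = Set.range (Nat.pair c ∘ g) := by
        rw [← hp, ← hp', hpp]
      obtain ⟨B, hB⟩ := (List.finite_toSet σ).bddAbove
      obtain ⟨k, hk⟩ := hg (2 * B + 1)
      obtain ⟨j, hj⟩ : Nat.pair c (2 * B + 1) ∈ Set.range (Nat.pair c ∘ f) :=
        heq ▸ ⟨k, by simp [hk]⟩
      have hj' : f j = 2 * B + 1 := (Nat.pair_eq_pair.1 hj).2
      have : 2 * B + 1 ∈ Set.range f := ⟨j, hj'⟩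
      rw [hf₂] at this
      rcases this with h | ⟨l, hl⟩
      · have := hB h
        omega
      · simp only at hl
        omega
    · obtain ⟨n, hn, hne⟩ := exists_diagStep_ne (c := c) (σ := σ) hpp
        (by rw [hcx, h₁]; exact Part.mem_some _) (by rw [hcx, h₂]; exact Part.mem_some _) m
      exact hne ((hstab n hn) ▸ hm n hn)

end Diagonalization

/-- EXL is Σ⁰₄-hard. -/
theorem EXL_sigma4_hard :
    ∀ P : Set ℕ, IsSigma4 P →
      ∃ g : ℕ → ℕ, Computable g ∧ ∀ e, e ∈ P ↔ g e ∈ EXL := by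
  intro P hP
  obtain ⟨S, hS, hPS⟩ := hP.exists_normal_form
  obtain ⟨g, hg, hgW⟩ := exists_computable_index (computable_familyMatrix hS)
  refine ⟨g, hg, fun e => ⟨fun he => ?_, fun he => ?_⟩⟩
  · refine mem_EXL_of_finite_exceptions ((hPS e).2 he)
      (fun i v hv => ((mem_column_iff (hgW e)).1 hv).1)
      (fun i hi => finite_column (hgW e) hi) (fun i => ?_) fun c v => ?_
    · by_cases hi : i.unpair.2 = 0
      · left
        rw [← hi, Nat.pair_unpair]
      · right
        ext w
        simp [mem_column_iff (hgW e), hi]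
    · simp only [mem_column_iff (hgW e), Nat.unpair_pair]
      rintro ⟨h, n, h1, h2⟩
      exact ⟨h, n, h1, h2.imp_right fun h => ⟨h.1, Or.inl one_ne_zero⟩⟩
  · by_contra hne
    exact not_mem_EXL (hgW e) ((hPS e).1 hne) he
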